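/- Let α : [0,∞) → [0,∞) be measurable, let μ be a nonnegative Borel measure on [0,∞) which is finite on bounded sets, and let u : [0,∞) → ℝ be locally μ-integrable such that u(t) ≤ α(t) + ∫_{[0,t)} u(s) dμ(s) for all t ≥ 0. Then u(t) ≤ α(t) + ∫_{[0,t)} α(s)·exp( μ((s,t)) ) dμ(s) for all t ≥ 0 (the right-hand side being interpreted in [0,∞]). -/

import Mathlib

open MeasureTheory

/-- The tail function `t ↦ ν (t, ∞)` of a finite measure is measurable. -/
theorem measurable_real_Ioi (ν : Measure ℝ) [IsFiniteMeasure ν] :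
    Measurable fun t : ℝ => ν.real (Set.Ioi t) := by
  have h : Antitone fun t : ℝ => ν.real (Set.Ioi t) := fun _ _ hst =>
    measureReal_mono (Set.Ioi_subset_Ioi hst)
  exact h.measurable

/-- The tail function of a finite measure is stochastically dominated by a uniform variable. -/
theorem measure_lt_real_Ioi_le (ν : Measure ℝ) [IsFiniteMeasure ν] (x : ℝ) :
    ν {t | x < ν.real (Set.Ioi t)} ≤ ENNReal.ofReal (ν.real Set.univ - x) := by
  have hm : MeasurableSet {t | x < ν.real (Set.Ioi t)} :=
    measurableSet_lt measurable_const (measurable_real_Ioi ν)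
  rw [hm.measure_eq_iSup_isCompact]
  refine iSup₂_le fun K hK => iSup_le fun hKc => ?_
  rcases K.eq_empty_or_nonempty with rfl | hne
  · simp
  obtain ⟨t, htK, ht⟩ := hKc.exists_isGreatest hne
  have hxt : x < ν.real (Set.Ioi t) := hK htK
  have hcompl : ν.real (Set.Iic t) = ν.real Set.univ - ν.real (Set.Ioi t) := by
    rw [← Set.compl_Ioi, measureReal_compl measurableSet_Ioi]
  calc ν K ≤ ν (Set.Iic t) := measure_mono fun y hy => ht hy
    _ = ENNReal.ofReal (ν.real (Set.Iic t)) := (ofReal_measureReal).symm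
    _ ≤ _ := ENNReal.ofReal_le_ofReal (by linarith)

theorem lintegral_Ioi_ofReal_sub_mul_exp {M : ℝ} (hM : 0 ≤ M) :
    ∫⁻ x in Set.Ioi (0 : ℝ), ENNReal.ofReal (M - x) * ENNReal.ofReal (Real.exp x) =
      ENNReal.ofReal (Real.exp M - 1 - M) := by
  have hzero : ∀ x ∈ Set.Ioi (0 : ℝ), x ∉ Set.Ioc 0 M →
      ENNReal.ofReal (M - x) * ENNReal.ofReal (Real.exp x) = 0 := by
    intro x hx hxM
    have : M - x ≤ 0 := by
      by_contra! h
      exact hxM ⟨hx, by linarith⟩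
    simp [ENNReal.ofReal_of_nonpos this]
  have hcont : Continuous fun x : ℝ => (M - x) * Real.exp x := by fun_prop
  have hderiv : ∀ x ∈ Set.uIcc 0 M,
      HasDerivAt (fun y : ℝ => (M - y + 1) * Real.exp y) ((M - x) * Real.exp x) x := by
    intro x _
    refine ((((hasDerivAt_id' x).const_sub M).add_const 1).mul
      (Real.hasDerivAt_exp x)).congr_deriv ?_
    ring
  have hint := intervalIntegral.integral_eq_sub_of_hasDerivAt hderiv
    (hcont.intervalIntegrable 0 M)
  rw [intervalIntegral.integral_of_le hM] at hint
  calc ∫⁻ x in Set.Ioi (0 : ℝ), ENNReal.ofReal (M - x) * ENNReal.ofReal (Real.exp x)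
      = ∫⁻ x in Set.Ioc 0 M, ENNReal.ofReal (M - x) * ENNReal.ofReal (Real.exp x) := by
        rw [← lintegral_indicator measurableSet_Ioi, ← lintegral_indicator measurableSet_Ioc]
        refine lintegral_congr fun x => ?_
        by_cases hx : x ∈ Set.Ioi (0 : ℝ)
        · by_cases hxM : x ∈ Set.Ioc 0 M
          · simp only [Set.indicator_of_mem hx, Set.indicator_of_mem hxM]
          · simp only [Set.indicator_of_mem hx, Set.indicator_of_notMem hxM, hzero x hx hxM]
        · have hxM : x ∉ Set.Ioc 0 M := fun h => hx h.1
          simp only [Set.indicator_of_notMem hx, Set.indicator_of_notMem hxM]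
    _ = ∫⁻ x in Set.Ioc 0 M, ENNReal.ofReal ((M - x) * Real.exp x) := by
        refine setLIntegral_congr_fun measurableSet_Ioc fun x hx => ?_
        exact (ENNReal.ofReal_mul (by linarith [hx.2])).symm
    _ = ENNReal.ofReal (∫ x in Set.Ioc 0 M, (M - x) * Real.exp x) := by
        refine (ofReal_integral_eq_lintegral_ofReal ?_ ?_).symm
        · exact (hcont.integrableOn_Icc).mono_set Set.Ioc_subset_Icc_self
        · refine (ae_restrict_iff' measurableSet_Ioc).2 (.of_forall fun x hx => ?_)
          exact mul_nonneg (by linarith [hx.2]) (Real.exp_pos x).le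
    _ = _ := by rw [hint]; congr 1; simp; ring

/-- The exponential of the tail function of a finite measure has integral at most `exp M - 1`,
where `M` is the total mass. -/
theorem lintegral_exp_real_Ioi_add_one_le (ν : Measure ℝ) [IsFiniteMeasure ν] :
    ∫⁻ t, ENNReal.ofReal (Real.exp (ν.real (Set.Ioi t))) ∂ν + 1 ≤
      ENNReal.ofReal (Real.exp (ν.real Set.univ)) := by
  set M := ν.real Set.univ with hMdef
  have hM : 0 ≤ M := measureReal_nonneg
  have hcake := lintegral_comp_eq_lintegral_meas_lt_mul ν (f := fun t => ν.real (Set.Ioi t))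
    (g := Real.exp) (.of_forall fun _ => measureReal_nonneg)
    (measurable_real_Ioi ν).aemeasurable
    (fun _ _ => Real.continuous_exp.intervalIntegrable _ _)
    (.of_forall fun x => (Real.exp_pos x).le)
  have hsub : ∫⁻ t, ENNReal.ofReal (Real.exp (ν.real (Set.Ioi t)) - 1) ∂ν ≤
      ENNReal.ofReal (Real.exp M - 1 - M) := by
    rw [← lintegral_Ioi_ofReal_sub_mul_exp hM]
    simp only [integral_exp, Real.exp_zero] at hcake
    rw [hcake]
    exact lintegral_mono fun x => mul_le_mul_left (measure_lt_real_Ioi_le ν x) _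
  have hsplit : ∀ t, ENNReal.ofReal (Real.exp (ν.real (Set.Ioi t))) =
      ENNReal.ofReal (Real.exp (ν.real (Set.Ioi t)) - 1) + 1 := by
    intro t
    rw [← ENNReal.ofReal_one, ← ENNReal.ofReal_add _ zero_le_one, sub_add_cancel]
    exact sub_nonneg.2 (Real.one_le_exp measureReal_nonneg)
  have hexp : 0 ≤ Real.exp M - 1 - M := by linarith [Real.add_one_le_exp M]
  simp_rw [hsplit]
  rw [lintegral_add_right _ measurable_const, lintegral_one, ← ofReal_measureReal (μ := ν),
    ← hMdef]
  calc _ ≤ ENNReal.ofReal (Real.exp M - 1 - M) + ENNReal.ofReal M + ENNReal.ofReal 1 := by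
        rw [ENNReal.ofReal_one]; gcongr
    _ = _ := by
        rw [← ENNReal.ofReal_add hexp hM, ← ENNReal.ofReal_add (by linarith) zero_le_one]
        congr 1; ring

theorem setLIntegral_Ioi_exp_real_Ioi_add_one_le (ν : Measure ℝ) [IsFiniteMeasure ν] (s : ℝ) :
    ∫⁻ t in Set.Ioi s, ENNReal.ofReal (Real.exp (ν.real (Set.Ioi t))) ∂ν + 1 ≤
      ENNReal.ofReal (Real.exp (ν.real (Set.Ioi s))) := by
  have h := lintegral_exp_real_Ioi_add_one_le (ν.restrict (Set.Ioi s))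
  rw [measureReal_restrict_apply_univ] at h
  convert h using 2
  refine setLIntegral_congr_fun measurableSet_Ioi fun t ht => ?_
  rw [measureReal_restrict_apply measurableSet_Ioi, Set.inter_eq_left.2]
  exact Set.Ioi_subset_Ioi (le_of_lt ht)

/-- Integrated Grönwall inequality for a finite measure on the line. -/
theorem lintegral_le_lintegral_mul_exp_real_Ioi (ν : Measure ℝ) [IsFiniteMeasure ν]
    {v a : ℝ → ENNReal} (hv : Measurable v) (ha : Measurable a) (hfin : ∫⁻ t, v t ∂ν ≠ ⊤)
    (h : ∀ᵐ t ∂ν, v t ≤ a t + ∫⁻ s in Set.Iio t, v s ∂ν) :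
    ∫⁻ t, v t ∂ν ≤ ∫⁻ t, a t * ENNReal.ofReal (Real.exp (ν.real (Set.Ioi t))) ∂ν := by
  set K : ℝ → ENNReal := fun t => ENNReal.ofReal (Real.exp (ν.real (Set.Ioi t))) with hK
  have hKm : Measurable K := (measurable_real_Ioi ν).exp.ennreal_ofReal
  set B : ENNReal := ∫⁻ s, v s * ∫⁻ t in Set.Ioi s, K t ∂ν ∂ν
  have hKs (s : ℝ) : ∫⁻ t in Set.Ioi s, K t ∂ν + 1 ≤ K s :=
    setLIntegral_Ioi_exp_real_Ioi_add_one_le ν s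
  have hKle (s : ℝ) : K s ≤ ENNReal.ofReal (Real.exp (ν.real Set.univ)) :=
    ENNReal.ofReal_le_ofReal (Real.exp_le_exp.2 (measureReal_mono (Set.subset_univ _)))
  have hB : B ≠ ⊤ := by
    refine ne_top_of_le_ne_top (ENNReal.mul_ne_top hfin
      (ENNReal.ofReal_ne_top (r := Real.exp (ν.real Set.univ)))) ?_
    rw [← lintegral_mul_const _ hv]
    exact lintegral_mono fun s => mul_le_mul_right ((le_self_add.trans (hKs s)).trans (hKle s)) _
  have hmeas : Measurable fun p : ℝ × ℝ =>
      {p : ℝ × ℝ | p.2 < p.1}.indicator (fun p => v p.2 * K p.1) p :=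
    ((hv.comp measurable_snd).mul (hKm.comp measurable_fst)).indicator
      (measurableSet_lt measurable_snd measurable_fst)
  have hswap : ∫⁻ t, (∫⁻ s in Set.Iio t, v s ∂ν) * K t ∂ν = B := by
    have h1 (t : ℝ) : (∫⁻ s in Set.Iio t, v s ∂ν) * K t =
        ∫⁻ s, {p : ℝ × ℝ | p.2 < p.1}.indicator (fun p => v p.2 * K p.1) (t, s) ∂ν := by
      rw [← lintegral_mul_const _ hv, ← lintegral_indicator measurableSet_Iio]
      rfl
    have h2 (s : ℝ) : v s * ∫⁻ t in Set.Ioi s, K t ∂ν =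
        ∫⁻ t, {p : ℝ × ℝ | p.2 < p.1}.indicator (fun p => v p.2 * K p.1) (t, s) ∂ν := by
      rw [← lintegral_const_mul _ hKm, ← lintegral_indicator measurableSet_Ioi]
      rfl
    simp only [B, h1, h2]
    exact lintegral_lintegral_swap hmeas.aemeasurable
  have key : ∫⁻ t, v t ∂ν + B ≤ ∫⁻ t, a t * K t ∂ν + B := by
    calc ∫⁻ t, v t ∂ν + B = ∫⁻ s, v s * (∫⁻ t in Set.Ioi s, K t ∂ν + 1) ∂ν := by
          rw [← lintegral_add_left hv]
          exact lintegral_congr fun s => by rw [mul_add, mul_one, add_comm]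
      _ ≤ ∫⁻ s, v s * K s ∂ν := lintegral_mono fun s => mul_le_mul_right (hKs s) _
      _ ≤ ∫⁻ t, (a t * K t + (∫⁻ s in Set.Iio t, v s ∂ν) * K t) ∂ν := by
          refine lintegral_mono_ae (h.mono fun t ht => ?_)
          rw [← add_mul]
          exact mul_le_mul_left ht _
      _ = _ := by rw [← hswap]; exact lintegral_add_left (ha.mul hKm) _
  exact (ENNReal.add_le_add_iff_right hB).1 key

theorem gronwall_measure (α : ℝ → ℝ) (hαm : Measurable α)
    (hα0 : ∀ t : ℝ, 0 ≤ t → 0 ≤ α t)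
    (μ : Measure ℝ)
    (hμ : ∀ s : Set ℝ, Bornology.IsBounded s → μ s < ⊤)
    (u : ℝ → ℝ) (hum : Measurable u)
    (huloc : ∀ T : ℝ, 0 < T → (∫⁻ s in Set.Ico (0 : ℝ) T, ENNReal.ofReal |u s| ∂μ) < ⊤)
    (hineq : ∀ t : ℝ, 0 ≤ t → u t ≤ α t + ∫ s in Set.Ico (0 : ℝ) t, u s ∂μ) :
    ∀ t : ℝ, 0 ≤ t →
      ENNReal.ofReal (u t) ≤
        ENNReal.ofReal (α t) +
          ∫⁻ s in Set.Ico (0 : ℝ) t,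
            ENNReal.ofReal (α s * Real.exp ((μ (Set.Ioo s t)).toReal)) ∂μ := by
  have hfin (t : ℝ) (ht : 0 ≤ t) : ∫⁻ s in Set.Ico (0 : ℝ) t, ENNReal.ofReal |u s| ∂μ < ⊤ :=
    (lintegral_mono_set (Set.Ico_subset_Ico_right (by linarith))).trans_lt
      (huloc (t + 1) (by linarith))
  have hpos (t : ℝ) (ht : 0 ≤ t) : ENNReal.ofReal (u t) ≤
      ENNReal.ofReal (α t) + ∫⁻ s in Set.Ico (0 : ℝ) t, ENNReal.ofReal (u s) ∂μ := by
    have hint : IntegrableOn u (Set.Ico 0 t) μ := by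
      refine ⟨hum.aestronglyMeasurable, ?_⟩
      rw [hasFiniteIntegral_iff_norm]
      exact hfin t ht
    calc ENNReal.ofReal (u t)
        ≤ ENNReal.ofReal (α t + ∫ s in Set.Ico (0 : ℝ) t, u s ∂μ) :=
          ENNReal.ofReal_le_ofReal (hineq t ht)
      _ ≤ ENNReal.ofReal (α t) + ENNReal.ofReal (∫ s in Set.Ico (0 : ℝ) t, u s ∂μ) :=
          ENNReal.ofReal_add_le
      _ ≤ _ := by
          gcongr
          rw [integral_eq_lintegral_pos_part_sub_lintegral_neg_part hint]
          exact (ENNReal.ofReal_le_ofReal (sub_le_self _ ENNReal.toReal_nonneg)).trans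
            ENNReal.ofReal_toReal_le
  intro T hT
  refine (hpos T hT).trans (add_le_add_right ?_ _)
  have : IsFiniteMeasure (μ.restrict (Set.Ico 0 T)) :=
    isFiniteMeasure_restrict.2 (hμ _ (Metric.isBounded_Ico 0 T)).ne
  refine (lintegral_le_lintegral_mul_exp_real_Ioi (μ.restrict (Set.Ico 0 T))
    hum.ennreal_ofReal hαm.ennreal_ofReal ?_ ?_).trans_eq ?_
  · refine ne_top_of_le_ne_top (hfin T hT).ne (lintegral_mono fun s => ?_)
    exact ENNReal.ofReal_le_ofReal (le_abs_self _)
  · refine (ae_restrict_iff' measurableSet_Ico).2 (.of_forall fun t ht => ?_)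
    rw [Measure.restrict_restrict measurableSet_Iio]
    convert hpos t ht.1 using 4
    ext s
    simp only [Set.mem_inter_iff, Set.mem_Iio, Set.mem_Ico]
    exact ⟨fun h => ⟨h.2.1, h.1⟩, fun h => ⟨h.2, h.1, h.2.trans ht.2⟩⟩
  · refine setLIntegral_congr_fun measurableSet_Ico fun s hs => ?_
    have hset : Set.Ioi s ∩ Set.Ico 0 T = Set.Ioo s T := by
      ext r
      simp only [Set.mem_inter_iff, Set.mem_Ioi, Set.mem_Ico, Set.mem_Ioo]
      exact ⟨fun h => ⟨h.1, h.2.2⟩, fun h => ⟨h.1, hs.1.trans h.1.le, h.2⟩⟩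
    rw [measureReal_restrict_apply measurableSet_Ioi, hset, ENNReal.ofReal_mul (hα0 s hs.1),
      measureReal_def]
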